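/- Let m ≥ 1 be an integer and set c = (m+1)·2^{−m}. Then for any digraph D, the hat number of the directed union D → K_m satisfies h(D → K_m) ≥ c·m/(m+1) + (1 − c)·h(D). -/

import Mathlib

namespace HatProblem

variable {V : Type*} [Fintype V] [DecidableEq V]

/-- A team strategy: each vertex maps a full configuration to a guess (`none` = pass),
depending only on the colors of its out-neighbors. -/
def IsStrategy (A : V → V → Prop) (S : V → (V → Bool) → Option Bool) : Prop :=
  ∀ (v : V) (c c' : V → Bool), (∀ u, A v u → c u = c' u) → S v c = S v c'

/-- The team wins at configuration `c`: someone guesses correctly, nobody guesses wrong. -/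
def Wins (S : V → (V → Bool) → Option Bool) (c : V → Bool) : Prop :=
  (∃ v, S v c = some (c v)) ∧ ∀ v b, S v c = some b → b = c v

/-- The chance of success of a strategy. -/
noncomputable def chance (S : V → (V → Bool) → Option Bool) : ℚ :=
  ({c : V → Bool | Wins S c}.ncard : ℚ) / 2 ^ Fintype.card V

/-- The hat number of a digraph: the maximal chance of success over all strategies. -/
noncomputable def hatNumber (A : V → V → Prop) : ℚ :=
  haveI : Fintype {S : V → (V → Bool) → Option Bool // IsStrategy A S} :=
    Fintype.ofFinite _
  Finset.sup' (Finset.univ : Finset {S : V → (V → Bool) → Option Bool // IsStrategy A S})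
    ⟨⟨fun _ _ => none, fun _ _ _ _ => rfl⟩, Finset.mem_univ _⟩
    fun S => chance S.1

/-- A clique in the skeleton of a digraph: vertices pairwise joined by arcs both ways. -/
def IsDiClique (A : V → V → Prop) (s : Finset V) : Prop :=
  ∀ x ∈ s, ∀ y ∈ s, x ≠ y → A x y ∧ A y x

/-- The clique number of a digraph: the clique number of its skeleton. -/
noncomputable def cliqueNum (A : V → V → Prop) : ℕ :=
  sSup {n | ∃ s : Finset V, IsDiClique A s ∧ s.card = n}

/-- The directed union `C → D` of two digraphs. -/
def dUnion {W : Type*} (A : V → V → Prop) (B : W → W → Prop) :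
    V ⊕ W → V ⊕ W → Prop
  | Sum.inl x, Sum.inl y => A x y
  | Sum.inl _, Sum.inr _ => True
  | Sum.inr _, Sum.inl _ => False
  | Sum.inr x, Sum.inr y => B x y

/-- The complete digraph on `m` vertices. -/
def completeArc (m : ℕ) : Fin m → Fin m → Prop := fun a b => a ≠ b

end HatProblem

namespace HatProblem

theorem exists_isStrategy_chance_eq_hatNumber {V : Type*} [Fintype V] [DecidableEq V]
    (A : V → V → Prop) : ∃ S, IsStrategy A S ∧ hatNumber A = chance S := by
  unfold hatNumber
  let : Fintype {S : V → (V → Bool) → Option Bool // IsStrategy A S} := Fintype.ofFinite _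
  obtain ⟨S, -, h⟩ := Finset.exists_mem_eq_sup'
    (s := (Finset.univ : Finset {S : V → (V → Bool) → Option Bool // IsStrategy A S}))
    ⟨⟨fun _ _ => none, fun _ _ _ _ => rfl⟩, Finset.mem_univ _⟩ fun S => chance S.1
  exact ⟨S.1, S.2, h⟩

theorem IsStrategy.chance_le_hatNumber {V : Type*} [Fintype V] [DecidableEq V]
    {A : V → V → Prop} {S : V → (V → Bool) → Option Bool} (hS : IsStrategy A S) :
    chance S ≤ hatNumber A := by
  unfold hatNumber
  let : Fintype {S : V → (V → Bool) → Option Bool // IsStrategy A S} := Fintype.ofFinite _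
  have h := Finset.le_sup' (s := Finset.univ)
    (fun S : {S : V → (V → Bool) → Option Bool // IsStrategy A S} => chance S.1)
    (Finset.mem_univ ⟨S, hS⟩)
  exact h

/-- The configuration in which only `i` has color `true`. -/
def singleConfig {W : Type*} [DecidableEq W] (i : W) : W → Bool := fun j => decide (j = i)

theorem singleConfig_injective {W : Type*} [DecidableEq W] :
    Function.Injective (singleConfig (W := W)) := fun i j h => by
  simpa [singleConfig] using congrFun h i

/-- The configurations in which at most one vertex has color `true`: the Hamming ball of
radius one around the constant configuration `false`. -/
def lightConfigs (W : Type*) [DecidableEq W] : Set (W → Bool) :=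
  insert (fun _ => false) (Set.range singleConfig)

theorem mem_lightConfigs_of_forall_ne {W : Type*} [DecidableEq W] {b : W → Bool} {i : W}
    (h : ∀ j, j ≠ i → b j = false) : b ∈ lightConfigs W := by
  cases hi : b i
  · refine Or.inl (funext fun j => ?_)
    by_cases hj : j = i
    · rw [hj, hi]
    · exact h j hj
  · refine Or.inr ⟨i, funext fun j => ?_⟩
    by_cases hj : j = i
    · simp [singleConfig, hj, hi]
    · simp [singleConfig, hj, h j hj]

theorem ncard_range_singleConfig (W : Type*) [Fintype W] [DecidableEq W] :
    (Set.range (singleConfig (W := W))).ncard = Fintype.card W := by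
  rw [← Set.image_univ, Set.ncard_image_of_injective _ singleConfig_injective,
    Set.ncard_univ, Nat.card_eq_fintype_card]

theorem two_pow_le_ncard_compl_lightConfigs (W : Type*) [Fintype W] [DecidableEq W] :
    2 ^ Fintype.card W ≤ (lightConfigs W)ᶜ.ncard + (Fintype.card W + 1) := by
  have h := Set.ncard_add_ncard_compl (lightConfigs W)
  have h₁ : (lightConfigs W).ncard ≤ Fintype.card W + 1 :=
    (Set.ncard_insert_le _ _).trans_eq (by rw [ncard_range_singleConfig])
  have h₂ : Nat.card (W → Bool) = 2 ^ Fintype.card W := by simp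
  omega

open Classical in
/-- The vertices of the second summand follow the Hamming ball strategy; those of the first
summand play `S` exactly when the second summand passes. -/
noncomputable def ballStrategy {V W : Type*} [DecidableEq W] (S : V → (V → Bool) → Option Bool) :
    V ⊕ W → (V ⊕ W → Bool) → Option Bool
  | Sum.inl v, c =>
    if (fun j => c (Sum.inr j)) ∈ lightConfigs W then none else S v fun u => c (Sum.inl u)
  | Sum.inr i, c => if ∀ j, j ≠ i → c (Sum.inr j) = false then some true else none

theorem IsStrategy.ballStrategy {V W : Type*} [DecidableEq W] {A : V → V → Prop}
    {S : V → (V → Bool) → Option Bool} (hS : IsStrategy A S) {B : W → W → Prop}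
    (hB : ∀ i j, i ≠ j → B i j) : IsStrategy (dUnion A B) (ballStrategy S) := by
  rintro (v | i) c c' h
  · have hr : (fun j => c (Sum.inr j)) = fun j => c' (Sum.inr j) :=
      funext fun j => h (Sum.inr j) trivial
    have hl := hS v (fun u => c (Sum.inl u)) (fun u => c' (Sum.inl u))
      fun u hu => h (Sum.inl u) hu
    classical exact if_congr (by rw [hr]) rfl hl
  · have hr : (∀ j, j ≠ i → c (Sum.inr j) = false) ↔ ∀ j, j ≠ i → c' (Sum.inr j) = false :=
      forall₂_congr fun j hj => by rw [h (Sum.inr j) (hB i j hj.symm)]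
    classical exact if_congr hr rfl rfl

theorem wins_ballStrategy_of_mem_range {V W : Type*} [DecidableEq W]
    (S : V → (V → Bool) → Option Bool) {c : V ⊕ W → Bool}
    (hc : (fun j => c (Sum.inr j)) ∈ Set.range singleConfig) : Wins (ballStrategy S) c := by
  classical
  obtain ⟨i, hi⟩ := hc
  have hi' : ∀ j, c (Sum.inr j) = decide (j = i) := fun j => (congrFun hi j).symm
  refine ⟨⟨Sum.inr i, ?_⟩, ?_⟩
  · simp [ballStrategy, hi']
  · rintro (v | j) b hb
    · have hl : (fun j => c (Sum.inr j)) ∈ lightConfigs W := by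
        refine mem_lightConfigs_of_forall_ne (i := i) fun j hj => ?_
        simp [hi', hj]
      have : ballStrategy S (Sum.inl v) c = none := if_pos hl
      simp [this] at hb
    · simp only [ballStrategy, ite_eq_iff, Option.some.injEq, reduceCtorEq, and_false,
        or_false] at hb
      obtain ⟨h, rfl⟩ := hb
      by_contra hne
      have hij : j ≠ i := by
        rintro rfl
        simp [hi'] at hne
      simpa [hi'] using h i hij.symm

theorem Wins.ballStrategy {V W : Type*} [DecidableEq W]
    {S : V → (V → Bool) → Option Bool} {c : V ⊕ W → Bool}
    (hw : Wins S fun u => c (Sum.inl u)) (hc : (fun j => c (Sum.inr j)) ∉ lightConfigs W) :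
    Wins (ballStrategy S) c := by
  have hl : ∀ v, HatProblem.ballStrategy S (Sum.inl v) c = S v fun u => c (Sum.inl u) :=
    fun _ => if_neg hc
  have hr : ∀ i, HatProblem.ballStrategy S (Sum.inr i) c = none := fun i =>
    if_neg fun h => hc (mem_lightConfigs_of_forall_ne h)
  obtain ⟨⟨v, hv⟩, hw⟩ := hw
  refine ⟨⟨Sum.inl v, (hl v).trans hv⟩, ?_⟩
  rintro (u | i) b hb
  · exact hw u b ((hl u).symm.trans hb)
  · simp [hr] at hb

theorem ncard_wins_ballStrategy_ge {V W : Type*} [Fintype V] [Fintype W] [DecidableEq W]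
    (S : V → (V → Bool) → Option Bool) :
    2 ^ Fintype.card V * Fintype.card W +
        {c | Wins S c}.ncard * (lightConfigs W)ᶜ.ncard ≤
      {c : V ⊕ W → Bool | Wins (ballStrategy S) c}.ncard := by
  have hV : (Set.univ : Set (V → Bool)).ncard = 2 ^ Fintype.card V := by
    classical simp [Set.ncard_univ]
  have hdisj : Disjoint ((Set.univ : Set (V → Bool)) ×ˢ Set.range (singleConfig (W := W)))
      ({c | Wins S c} ×ˢ (lightConfigs W)ᶜ) :=
    Set.disjoint_prod.2 (Or.inr (Set.disjoint_compl_right_iff_subset.2 (Set.subset_insert _ _)))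
  rw [← hV, ← ncard_range_singleConfig W, ← Set.ncard_prod, ← Set.ncard_prod,
    ← Set.ncard_union_eq hdisj,
    ← Set.ncard_image_of_injective _ (Equiv.sumArrowEquivProdArrow V W Bool).symm.injective]
  refine Set.ncard_le_ncard ?_
  rintro _ ⟨⟨a, b⟩, ⟨-, hb⟩ | ⟨ha, hb⟩, rfl⟩
  · exact wins_ballStrategy_of_mem_range S hb
  · exact Wins.ballStrategy (S := S) ha hb

/-- For `m ≥ 1` and `c = (m+1)·2^{-m}`, any digraph `D` satisfies
`h(D → K_m) ≥ c·m/(m+1) + (1-c)·h(D)`. -/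
theorem hatNumber_dUnion_Km_ge {V : Type*} [Fintype V] [DecidableEq V]
    (m : ℕ) (hm : 1 ≤ m) (A : V → V → Prop) (hA : Irreflexive A) :
    (((m : ℚ) + 1) / 2 ^ m) * ((m : ℚ) / ((m : ℚ) + 1)) +
        (1 - ((m : ℚ) + 1) / 2 ^ m) * hatNumber A ≤
      hatNumber (dUnion A (completeArc m)) := by
  obtain ⟨S, hS, hmax⟩ := exists_isStrategy_chance_eq_hatNumber A
  refine le_trans ?_ (hS.ballStrategy fun _ _ h => h).chance_le_hatNumber
  have hcount := ncard_wins_ballStrategy_ge (W := Fin m) S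
  have hheavy := two_pow_le_ncard_compl_lightConfigs (Fin m)
  rw [Fintype.card_fin] at hcount hheavy
  rw [hmax]
  unfold chance
  rw [Fintype.card_sum, Fintype.card_fin, pow_add, le_div_iff₀ (by positivity)]
  generalize {c | Wins S c}.ncard = w at *
  generalize (lightConfigs (Fin m))ᶜ.ncard = k at *
  have hcount' := (Nat.cast_le (α := ℚ)).2 hcount
  have hheavy' := (Nat.cast_le (α := ℚ)).2 hheavy
  push_cast at hcount' hheavy'
  refine le_trans ?_ hcount'
  have hw : (w : ℚ) * (2 ^ m - (m + 1)) ≤ w * k :=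
    mul_le_mul_of_nonneg_left (by linarith) w.cast_nonneg
  have hm' : (m : ℚ) + 1 ≠ 0 := by positivity
  calc _ = 2 ^ Fintype.card V * (m : ℚ) + w * (2 ^ m - (m + 1)) := by
        field_simp
    _ ≤ _ := by linarith

end HatProblem
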